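/- Second-order vanishing of flat-band eigenfunctions in the first representation: Let U be a tunnelling potential and consider the chiral model D(α). If u ∈ Ker₁(α), then there exists a smooth function w : ℂ → ℂ² such that u(z) = z²·w(z) for all z ∈ ℂ. -/

import Mathlib

noncomputable section

open Complex MeasureTheory

namespace TBG

/-- `ω = exp(2πi/3)`. -/
def ω : ℂ := Complex.exp (2 * Real.pi * Complex.I / 3)

/-- The moiré lattice `Λ = ℤω + ℤ ⊂ ℂ`. -/
def Λ : Set ℂ := {z : ℂ | ∃ m n : ℤ, z = m * ω + n}

/-- The dual lattice `Λ* = (4πi/√3)·Λ`. -/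
def Λdual : Set ℂ := {p : ℂ | ∃ m n : ℤ, p = 4 * Real.pi * Complex.I / Real.sqrt 3 * (m * ω + n)}

/-- The high symmetry point `K = 4π/3`. -/
def K : ℂ := 4 * Real.pi / 3

/-- `⟨z,w⟩ = Re (z · conj w)`. -/
def pair (z w : ℂ) : ℝ := (z * (starRingEnd ℂ) w).re

/-- `2 D_z̄ f = (1/i)(∂_x f + i ∂_y f)`. -/
def Dbar (f : ℂ → ℂ) (z : ℂ) : ℂ :=
  1 / Complex.I * (fderiv ℝ f z 1 + Complex.I * fderiv ℝ f z Complex.I)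

/-- A tunnelling potential: smooth, with the translational and rotational symmetries. -/
def IsTunnelling (U : ℂ → ℂ) : Prop :=
  ContDiff ℝ (⊤ : ℕ∞) U ∧
    (∀ γ ∈ Λ, ∀ z : ℂ, U (z + γ) = Complex.exp (Complex.I * (pair γ K : ℂ)) * U z) ∧
    ∀ z : ℂ, U (ω * z) = ω * U z

/-- Membership in `ker_{L²₀}(D(α)+k)` for the chiral model with tunnelling
potentials `U₊ = Up`, `U₋ = Um`: smooth solutions of `(D(α)+k)u = 0` with the
Floquet boundary conditions. -/
def InKer (Up Um : ℂ → ℂ) (α k : ℂ) (u : ℂ → ℂ × ℂ) : Prop :=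
  ContDiff ℝ (⊤ : ℕ∞) u ∧
    (∀ z : ℂ, Dbar (fun w => (u w).1) z + k * (u z).1 + α * Up z * (u z).2 = 0) ∧
    (∀ z : ℂ, Dbar (fun w => (u w).2) z + k * (u z).2 + α * Um z * (u z).1 = 0) ∧
    (∀ γ ∈ Λ, ∀ z : ℂ, (u (z + γ)).1 = Complex.exp (-Complex.I * (pair γ K : ℂ)) * (u z).1) ∧
    (∀ γ ∈ Λ, ∀ z : ℂ, (u (z + γ)).2 = Complex.exp (Complex.I * (pair γ K : ℂ)) * (u z).2)

/-- `Ker(α,k)` as a set of functions. -/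
def kerSet (Up Um : ℂ → ℂ) (α k : ℂ) : Set (ℂ → ℂ × ℂ) := {u | InKer Up Um α k u}

/-- `dim_ℂ Ker(α,k)` (the set `Ker(α,k)` is a linear subspace, so the finrank of its span
is its dimension). -/
def kerDim (Up Um : ℂ → ℂ) (α k : ℂ) : ℕ :=
  Module.finrank ℂ ↥(Submodule.span ℂ (kerSet Up Um α k))

/-- `Ker_p(α) = {u ∈ Ker(α,0) : u(ωz) = ω^(−p)·u(z)}`. -/
def kerPSet (Up Um : ℂ → ℂ) (α : ℂ) (p : ℕ) : Set (ℂ → ℂ × ℂ) :=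
  {u | u ∈ kerSet Up Um α 0 ∧ ∀ z : ℂ, u (ω * z) = (ω ^ (-(p : ℤ))) • u z}

/-- `dim_ℂ Ker_p(α)`. -/
def kerPDim (Up Um : ℂ → ℂ) (α : ℂ) (p : ℕ) : ℕ :=
  Module.finrank ℂ ↥(Submodule.span ℂ (kerPSet Up Um α p))

/-- `α` is magic: the flat band condition `Ker(α,k) ≠ {0}` for every `k`. -/
def IsMagic (Up Um : ℂ → ℂ) (α : ℂ) : Prop :=
  ∀ k : ℂ, ∃ u ∈ kerSet Up Um α k, u ≠ 0


section RadialMean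

variable {E : Type} [NormedAddCommGroup E] [NormedSpace ℝ E]

/-- The weighted mean `∫₀¹ tᵏ f(tz) dt` of `f` along the segment from `0` to `z`. -/
def radialMean (k : ℕ) (f : ℂ → E) (z : ℂ) : E :=
  ∫ t in (0 : ℝ)..1, t ^ k • f (t • z)

theorem hasFDerivAt_radialMean {f : ℂ → E} (hf : ContDiff ℝ 1 f) (k : ℕ) (z : ℂ) :
    HasFDerivAt (radialMean k f) (radialMean (k + 1) (fderiv ℝ f) z) z := by
  have hc : Continuous f := hf.continuous
  have hc' : Continuous (fderiv ℝ f) := hf.continuous_fderiv one_ne_zero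
  obtain ⟨C, hC⟩ := (isCompact_closedBall (0 : ℂ) (‖z‖ + 1)).exists_bound_of_continuousOn
    hc'.continuousOn
  refine intervalIntegral.hasFDerivAt_integral_of_dominated_of_fderiv_le
    (F := fun z t => t ^ k • f (t • z))
    (F' := fun z t => t ^ (k + 1) • fderiv ℝ f (t • z)) (bound := fun _ => C)
    (Metric.ball_mem_nhds z one_pos) ?_ ?_ ?_ ?_ ?_ ?_
  · exact .of_forall fun x => Continuous.aestronglyMeasurable (by fun_prop)
  · exact Continuous.intervalIntegrable (by fun_prop) _ _
  · exact Continuous.aestronglyMeasurable (by fun_prop)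
  · refine .of_forall fun t ht x hx => ?_
    rw [Set.uIoc_of_le zero_le_one] at ht
    have hx' : ‖x‖ ≤ ‖z‖ + 1 := by
      have h₁ : ‖x - z‖ < 1 := by simpa [dist_eq_norm] using hx
      have h₂ := norm_le_norm_add_norm_sub z x
      rw [norm_sub_rev] at h₂
      linarith
    have htx : t • x ∈ Metric.closedBall (0 : ℂ) (‖z‖ + 1) := by
      rw [mem_closedBall_zero_iff, norm_smul, Real.norm_of_nonneg ht.1.le]
      exact (mul_le_of_le_one_left (norm_nonneg x) ht.2).trans hx'
    rw [norm_smul, norm_pow, Real.norm_of_nonneg ht.1.le]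
    exact (mul_le_of_le_one_left (norm_nonneg _) (pow_le_one₀ ht.1.le ht.2)).trans (hC _ htx)
  · exact intervalIntegrable_const
  · refine .of_forall fun t _ x _ => ?_
    have h := ((hf.differentiable one_ne_zero (t • x)).hasFDerivAt.comp x
      ((hasFDerivAt_id x).const_smul t)).const_smul (t ^ k)
    refine h.congr_fderiv ?_
    ext v
    simp [pow_succ, mul_smul]

theorem contDiff_radialMean_nat (n : ℕ) {E : Type} [NormedAddCommGroup E] [NormedSpace ℝ E]
    {f : ℂ → E} (hf : ContDiff ℝ (⊤ : ℕ∞) f) (k : ℕ) : ContDiff ℝ n (radialMean k f) := by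
  induction n generalizing E f k with
  | zero =>
    exact contDiff_zero.2 <| continuous_iff_continuousAt.2 fun z =>
      (hasFDerivAt_radialMean (hf.of_le (mod_cast le_top)) k z).continuousAt
  | succ n ih =>
    exact contDiff_succ_iff_hasFDerivAt.2 ⟨_, ih (contDiff_infty_iff_fderiv.1 hf).2 (k + 1),
      hasFDerivAt_radialMean (hf.of_le (mod_cast le_top)) k⟩

theorem contDiff_radialMean {f : ℂ → E} (hf : ContDiff ℝ (⊤ : ℕ∞) f) (k : ℕ) :
    ContDiff ℝ (⊤ : ℕ∞) (radialMean k f) :=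
  contDiff_infty.2 fun n => contDiff_radialMean_nat n hf k

theorem radialMean_clm_apply {F : Type} [NormedAddCommGroup F] [NormedSpace ℝ F]
    [CompleteSpace E] [CompleteSpace F] (L : E →L[ℝ] F) {f : ℂ → E} (hf : Continuous f)
    (k : ℕ) (z : ℂ) :
    L (radialMean k f z) = radialMean k (fun w => L (f w)) z := by
  have hi : IntervalIntegrable (fun t : ℝ => t ^ k • f (t • z)) volume 0 1 :=
    Continuous.intervalIntegrable (by fun_prop) _ _
  simp only [radialMean, ← L.intervalIntegral_comp_comm hi, map_smul]

theorem add_radialMean_fderiv [CompleteSpace E] {f : ℂ → E} (hf : ContDiff ℝ 1 f) (z : ℂ) :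
    f z = f 0 + radialMean 0 (fderiv ℝ f) z z := by
  have hc' : Continuous (fderiv ℝ f) := hf.continuous_fderiv one_ne_zero
  have hd : ∀ t ∈ Set.uIcc (0 : ℝ) 1,
      HasDerivAt (fun t : ℝ => f (t • z)) (fderiv ℝ f (t • z) z) t := fun t _ => by
    have h := (hf.differentiable one_ne_zero (t • z)).hasFDerivAt.comp_hasDerivAt t
      ((hasDerivAt_id t).smul_const z)
    simpa [Function.comp_def] using h
  have h := intervalIntegral.integral_eq_sub_of_hasDerivAt hd
    (Continuous.intervalIntegrable (by fun_prop) _ _)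
  have h' := radialMean_clm_apply (ContinuousLinearMap.apply ℝ E z) hc' 0 z
  simp only [radialMean, pow_zero, one_smul, ContinuousLinearMap.apply_apply] at h' ⊢
  rw [h', h]
  simp

end RadialMean

section Dbar

/-- The symbol of `Dbar`, as a linear map on real differentials. -/
def dbarSymbol : (ℂ →L[ℝ] ℂ) →L[ℝ] ℂ :=
  (1 / Complex.I) • (ContinuousLinearMap.apply ℝ ℂ (1 : ℂ) +
    Complex.I • ContinuousLinearMap.apply ℝ ℂ Complex.I)

theorem dbarSymbol_apply (L : ℂ →L[ℝ] ℂ) :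
    dbarSymbol L = 1 / Complex.I * (L 1 + Complex.I * L Complex.I) := rfl

theorem Dbar_eq (f : ℂ → ℂ) : Dbar f = fun z => dbarSymbol (fderiv ℝ f z) := rfl

theorem contDiff_Dbar {f : ℂ → ℂ} (hf : ContDiff ℝ (⊤ : ℕ∞) f) :
    ContDiff ℝ (⊤ : ℕ∞) (Dbar f) :=
  dbarSymbol.contDiff.comp (contDiff_infty_iff_fderiv.1 hf).2

theorem Dbar_add {f g : ℂ → ℂ} {z : ℂ} (hf : DifferentiableAt ℝ f z)
    (hg : DifferentiableAt ℝ g z) :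
    Dbar (fun w => f w + g w) z = Dbar f z + Dbar g z := by
  simp only [Dbar_eq, fderiv_fun_add hf hg, map_add]

theorem Dbar_mul {f g : ℂ → ℂ} {z : ℂ} (hf : DifferentiableAt ℝ f z)
    (hg : DifferentiableAt ℝ g z) :
    Dbar (fun w => f w * g w) z = f z * Dbar g z + g z * Dbar f z := by
  simp only [Dbar, fderiv_fun_mul hf hg, add_apply, smul_apply, smul_eq_mul]
  ring

theorem Dbar_id (z : ℂ) : Dbar (fun w => w) z = 0 := by
  simp [Dbar]

theorem Dbar_radialMean {f : ℂ → ℂ} (hf : ContDiff ℝ (⊤ : ℕ∞) f) (k : ℕ) :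
    Dbar (radialMean k f) = radialMean (k + 1) (Dbar f) := by
  funext z
  simp only [Dbar_eq]
  rw [(hasFDerivAt_radialMean (hf.of_le (mod_cast le_top)) k z).fderiv,
    radialMean_clm_apply dbarSymbol (contDiff_infty_iff_fderiv.1 hf).2.continuous]

theorem Dbar_const_mul (c : ℂ) {f : ℂ → ℂ} (hf : ContDiff ℝ (⊤ : ℕ∞) f) :
    Dbar (fun z => c * f z) = fun z => c * Dbar f z := by
  funext z
  rw [Dbar_mul (differentiableAt_const c) (hf.differentiable (by simp) z)]
  simp [Dbar]

/-- Smooth functions all of whose pure antiholomorphic derivatives vanish at the origin. -/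
def DbarFlat (f : ℂ → ℂ) : Prop :=
  ContDiff ℝ (⊤ : ℕ∞) f ∧ ∀ n : ℕ, Dbar^[n] f 0 = 0

theorem DbarFlat.const_mul (c : ℂ) {f : ℂ → ℂ} (hf : DbarFlat f) :
    DbarFlat (fun z => c * f z) := by
  have key : ∀ n : ℕ, ∀ g : ℂ → ℂ, ContDiff ℝ (⊤ : ℕ∞) g →
      Dbar^[n] (fun z => c * g z) = fun z => c * Dbar^[n] g z := by
    intro n
    induction n with
    | zero => intros; rfl
    | succ n ih =>
      intro g hg
      rw [Function.iterate_succ_apply, Dbar_const_mul c hg, ih _ (contDiff_Dbar hg)]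
      rfl
  exact ⟨contDiff_const.mul hf.1, fun n => by simp [key n f hf.1, hf.2 n]⟩

theorem DbarFlat.radialMean_Dbar {f : ℂ → ℂ} (hf : DbarFlat f) :
    DbarFlat (radialMean 0 (Dbar f)) := by
  have key : ∀ n k : ℕ, ∀ g : ℂ → ℂ, ContDiff ℝ (⊤ : ℕ∞) g →
      Dbar^[n] (radialMean k g) = radialMean (k + n) (Dbar^[n] g) := by
    intro n
    induction n with
    | zero => intros; rfl
    | succ n ih =>
      intro k g hg
      rw [Function.iterate_succ_apply, Dbar_radialMean hg, ih _ _ (contDiff_Dbar hg),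
        Function.iterate_succ_apply, add_right_comm, add_assoc]
  refine ⟨contDiff_radialMean (contDiff_Dbar hf.1) 0, fun n => ?_⟩
  rw [key n 0 _ (contDiff_Dbar hf.1), ← Function.iterate_succ_apply]
  simp only [radialMean, smul_zero, hf.2 (n + 1), intervalIntegral.integral_zero]

/-- A real linear map in terms of its holomorphic and antiholomorphic parts. -/
theorem clm_apply_eq_wirtinger (L : ℂ →L[ℝ] ℂ) (z : ℂ) :
    L z = z * (1 / 2 * (L 1 - Complex.I * L Complex.I)) +
      (starRingEnd ℂ) z * (Complex.I / 2 * dbarSymbol L) := by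
  have hz : z = z.re • (1 : ℂ) + z.im • Complex.I := by
    simp [Complex.re_add_im]
  have hL : L z = z.re * L 1 + z.im * L Complex.I := by
    conv_lhs => rw [hz]
    rw [map_add, L.map_smul, L.map_smul, Complex.real_smul, Complex.real_smul]
  have hz' : z = z.re + z.im * Complex.I := (Complex.re_add_im z).symm
  have hc : (starRingEnd ℂ) z = z.re - z.im * Complex.I := by
    apply Complex.ext <;> simp
  rw [hL, hc, dbarSymbol_apply]
  conv_rhs => enter [1, 1]; rw [hz']
  have hI : Complex.I ≠ 0 := Complex.I_ne_zero
  field_simp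
  ring_nf
  simp only [Complex.I_sq]
  ring

theorem DbarFlat.exists_eq_mul_add_conj_mul {f : ℂ → ℂ} (hf : DbarFlat f) :
    ∃ g h : ℂ → ℂ, ContDiff ℝ (⊤ : ℕ∞) g ∧ DbarFlat h ∧
      ∀ z, f z = z * g z + (starRingEnd ℂ) z * h z := by
  have hd : ContDiff ℝ (⊤ : ℕ∞) (fderiv ℝ f) := (contDiff_infty_iff_fderiv.1 hf.1).2
  have hm := contDiff_radialMean hd 0
  refine ⟨fun z => 1 / 2 * (radialMean 0 (fderiv ℝ f) z 1 -
    Complex.I * radialMean 0 (fderiv ℝ f) z Complex.I),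
    fun z => Complex.I / 2 * radialMean 0 (Dbar f) z, ?_, hf.radialMean_Dbar.const_mul _, ?_⟩
  · fun_prop
  · intro z
    have h0 : f 0 = 0 := hf.2 0
    rw [add_radialMean_fderiv (hf.1.of_le (mod_cast le_top)) z, h0, zero_add,
      clm_apply_eq_wirtinger, radialMean_clm_apply dbarSymbol hd.continuous]
    rfl

theorem DbarFlat.exists_eq_mul_add_conj_pow_mul {f : ℂ → ℂ} (hf : DbarFlat f) (N : ℕ) :
    ∃ g h : ℂ → ℂ, ContDiff ℝ (⊤ : ℕ∞) g ∧ DbarFlat h ∧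
      ∀ z, f z = z * g z + (starRingEnd ℂ) z ^ N * h z := by
  induction N with
  | zero => exact ⟨0, f, contDiff_const, hf, fun z => by simp⟩
  | succ N ih =>
    obtain ⟨g, h, hg, hh, hfe⟩ := ih
    obtain ⟨g', h', hg', hh', hhe⟩ := hh.exists_eq_mul_add_conj_mul
    refine ⟨fun z => g z + (starRingEnd ℂ) z ^ N * g' z, h', ?_, hh', fun z => ?_⟩
    · exact hg.add ((Complex.conjCLE.contDiff.pow N).mul hg')
    · rw [hfe, hhe]
      ring

end Dbar

theorem norm_conj_pow_div_pow (z : ℂ) (m j : ℕ) :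
    ‖(starRingEnd ℂ) z ^ (m + j + 1) / z ^ m‖ = ‖z‖ ^ (j + 1) := by
  rcases eq_or_ne z 0 with rfl | hz
  · simp
  · have : ‖z‖ ≠ 0 := norm_ne_zero_iff.2 hz
    rw [norm_div, norm_pow, norm_pow, Complex.norm_conj]
    field_simp
    ring

theorem hasFDerivAt_conj_pow_div_pow (m j : ℕ) (z : ℂ) :
    HasFDerivAt (𝕜 := ℝ) (fun z : ℂ => (starRingEnd ℂ) z ^ (m + (j + 1) + 1) / z ^ m)
      (((m + (j + 1) + 1 : ℕ) * ((starRingEnd ℂ) z ^ (m + j + 1) / z ^ m)) •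
          (Complex.conjCLE : ℂ →L[ℝ] ℂ) -
        (m * ((starRingEnd ℂ) z ^ (m + 1 + j + 1) / z ^ (m + 1))) •
          ContinuousLinearMap.id ℝ ℂ) z := by
  rcases eq_or_ne z 0 with rfl | hz
  · have hO : (fun z : ℂ => (starRingEnd ℂ) z ^ (m + (j + 1) + 1) / z ^ m)
        =O[nhds 0] fun z : ℂ => z ^ (j + 2) :=
      Asymptotics.isBigO_of_le _ fun z => by rw [norm_conj_pow_div_pow, norm_pow]
    have ho : (fun z : ℂ => z ^ (j + 2)) =o[nhds 0] fun z : ℂ => z :=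
      Asymptotics.isLittleO_pow_id (by omega)
    refine (HasFDerivAt.of_isLittleO (f' := 0) ?_).congr_fderiv ?_
    · simpa using hO.trans_isLittleO ho
    · ext v
      simp
  · have h₁ : HasFDerivAt (𝕜 := ℝ) (fun z : ℂ => (starRingEnd ℂ) z ^ (m + (j + 1) + 1)) _ z :=
      (Complex.conjCLE.hasFDerivAt (x := z)).pow (m + (j + 1) + 1)
    have h₂ : HasFDerivAt (𝕜 := ℝ) (fun z : ℂ => z ^ m) _ z := (hasFDerivAt_id z).pow m
    have hi : HasFDerivAt (𝕜 := ℝ) Inv.inv _ (z ^ m) := hasFDerivAt_inv' (pow_ne_zero m hz)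
    have h₃ : HasFDerivAt (𝕜 := ℝ) (fun z : ℂ => (z ^ m)⁻¹) _ z :=
      HasFDerivAt.comp (f := fun z : ℂ => z ^ m) z hi h₂
    refine (h₁.mul h₃).congr_fderiv ?_
    ext v
    rcases m with _ | m
    · simp
    · simp
      field_simp
      ring

theorem contDiff_conj_pow_div_pow (k m N : ℕ) (hN : m + k + 1 ≤ N) :
    ContDiff ℝ k (fun z : ℂ => (starRingEnd ℂ) z ^ N / z ^ m) := by
  induction k generalizing m N with
  | zero =>
    obtain ⟨j, rfl⟩ := Nat.exists_eq_add_of_le hN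
    refine contDiff_zero.2 <| continuous_iff_continuousAt.2 fun z => ?_
    rcases eq_or_ne z 0 with rfl | hz
    · have e : m + 0 + 1 + j = m + j + 1 := by ring
      rw [e, ContinuousAt]
      simp only [map_zero, ne_eq, Nat.add_eq_zero_iff, one_ne_zero, and_false, not_false_eq_true,
        zero_pow, zero_div]
      refine tendsto_zero_iff_norm_tendsto_zero.2 ?_
      simp only [norm_conj_pow_div_pow]
      have h : Continuous fun z : ℂ => ‖z‖ ^ (j + 1) := by fun_prop
      simpa using h.tendsto 0
    · exact ((Complex.continuous_conj.pow _).continuousAt).div (continuousAt_id.pow _)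
        (pow_ne_zero m hz)
  | succ k ih =>
    obtain ⟨j, rfl⟩ := Nat.exists_eq_add_of_le hN
    have e : m + (k + 1) + 1 + j = m + ((k + j) + 1) + 1 := by ring
    rw [e]
    refine contDiff_succ_iff_hasFDerivAt.2 ⟨_, ?_, hasFDerivAt_conj_pow_div_pow m (k + j)⟩
    have h₁ := ih m (m + (k + j) + 1) (by omega)
    have h₂ := ih (m + 1) (m + 1 + (k + j) + 1) (by omega)
    exact ((contDiff_const.mul h₁).smul contDiff_const).sub
      ((contDiff_const.mul h₂).smul contDiff_const)

theorem eq_of_forall_ne_zero {f g : ℂ → ℂ} (hf : Continuous f) (hg : Continuous g)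
    (h : ∀ z ≠ 0, f z = g z) : f = g :=
  hf.ext_on (dense_compl_singleton (0 : ℂ)) hg h

/-- Division by `z` preserves smoothness of functions flat in the antiholomorphic direction. -/
theorem DbarFlat.exists_eq_mul {f : ℂ → ℂ} (hf : DbarFlat f) :
    ∃ v : ℂ → ℂ, ContDiff ℝ (⊤ : ℕ∞) v ∧ ∀ z, f z = z * v z := by
  have key : ∀ k : ℕ, ∃ v : ℂ → ℂ, ContDiff ℝ k v ∧ ∀ z, f z = z * v z := by
    intro k
    obtain ⟨g, h, hg, hh, hfe⟩ := hf.exists_eq_mul_add_conj_pow_mul (k + 2)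
    refine ⟨fun z => g z + (starRingEnd ℂ) z ^ (k + 2) / z ^ 1 * h z, ?_, fun z => ?_⟩
    · exact (hg.of_le (mod_cast le_top)).add
        ((contDiff_conj_pow_div_pow k 1 (k + 2) (by omega)).mul (hh.1.of_le (mod_cast le_top)))
    · rw [hfe]
      rcases eq_or_ne z 0 with rfl | hz
      · simp
      · field_simp
  choose v hv hfv using key
  refine ⟨v 0, contDiff_infty.2 fun k => ?_, hfv 0⟩
  rw [eq_of_forall_ne_zero (hv 0).continuous (hv k).continuous fun z hz =>
    mul_left_cancel₀ hz ((hfv 0 z).symm.trans (hfv k z))]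
  exact hv k

section System

variable {a b u₁ u₂ : ℂ → ℂ}

theorem dbarFlat_of_system (ha : ContDiff ℝ (⊤ : ℕ∞) a) (hb : ContDiff ℝ (⊤ : ℕ∞) b)
    (h₁ : ContDiff ℝ (⊤ : ℕ∞) u₁) (h₂ : ContDiff ℝ (⊤ : ℕ∞) u₂)
    (e₁ : ∀ z, Dbar u₁ z + a z * u₂ z = 0) (e₂ : ∀ z, Dbar u₂ z + b z * u₁ z = 0)
    (z₁ : u₁ 0 = 0) (z₂ : u₂ 0 = 0) : DbarFlat u₁ := by
  have key : ∀ n : ℕ, ∀ p q : ℂ → ℂ, ContDiff ℝ (⊤ : ℕ∞) p → ContDiff ℝ (⊤ : ℕ∞) q →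
      Dbar^[n] (fun z => p z * u₁ z + q z * u₂ z) 0 = 0 := by
    intro n
    induction n with
    | zero => intro p q _ _; simp [z₁, z₂]
    | succ n ih =>
      intro p q hp hq
      have hD : Dbar (fun z => p z * u₁ z + q z * u₂ z) =
          fun z => (Dbar p z - q z * b z) * u₁ z + (Dbar q z - p z * a z) * u₂ z := by
        funext z
        have d : ∀ {f : ℂ → ℂ}, ContDiff ℝ (⊤ : ℕ∞) f → DifferentiableAt ℝ f z :=
          fun hf => hf.differentiable (by simp) z
        rw [Dbar_add (d (hp.mul h₁)) (d (hq.mul h₂)), Dbar_mul (d hp) (d h₁),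
          Dbar_mul (d hq) (d h₂)]
        linear_combination p z * e₁ z + q z * e₂ z
      rw [Function.iterate_succ_apply, hD]
      exact ih _ _ ((contDiff_Dbar hp).sub (hq.mul hb)) ((contDiff_Dbar hq).sub (hp.mul ha))
  exact ⟨h₁, fun n => by simpa using key n (fun _ => 1) (fun _ => 0) contDiff_const contDiff_const⟩

theorem system_of_eq_mul {v₁ v₂ : ℂ → ℂ} (ha : Continuous a) (hv₁ : ContDiff ℝ (⊤ : ℕ∞) v₁)
    (hv₂ : Continuous v₂) (e₁ : ∀ z, Dbar u₁ z + a z * u₂ z = 0)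
    (huv₁ : ∀ z, u₁ z = z * v₁ z) (huv₂ : ∀ z, u₂ z = z * v₂ z) (z : ℂ) :
    Dbar v₁ z + a z * v₂ z = 0 := by
  refine congrFun (eq_of_forall_ne_zero (f := fun z => Dbar v₁ z + a z * v₂ z) (g := fun _ => 0)
    ((contDiff_Dbar hv₁).continuous.add (ha.mul hv₂)) continuous_const fun z hz => ?_) z
  have h := e₁ z
  rw [funext huv₁, Dbar_mul differentiableAt_fun_id (hv₁.differentiable (by simp) z), Dbar_id,
    huv₂] at h
  refine (mul_eq_zero.1 (?_ : z * (Dbar v₁ z + a z * v₂ z) = 0)).resolve_left hz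
  linear_combination h

/-- Solutions of the system vanishing at the origin are divisible by `z`, with a quotient
solving the same system. -/
theorem exists_system_eq_mul (ha : ContDiff ℝ (⊤ : ℕ∞) a) (hb : ContDiff ℝ (⊤ : ℕ∞) b)
    (h₁ : ContDiff ℝ (⊤ : ℕ∞) u₁) (h₂ : ContDiff ℝ (⊤ : ℕ∞) u₂)
    (e₁ : ∀ z, Dbar u₁ z + a z * u₂ z = 0) (e₂ : ∀ z, Dbar u₂ z + b z * u₁ z = 0)
    (z₁ : u₁ 0 = 0) (z₂ : u₂ 0 = 0) :
    ∃ v₁ v₂ : ℂ → ℂ, ContDiff ℝ (⊤ : ℕ∞) v₁ ∧ ContDiff ℝ (⊤ : ℕ∞) v₂ ∧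
      (∀ z, Dbar v₁ z + a z * v₂ z = 0) ∧ (∀ z, Dbar v₂ z + b z * v₁ z = 0) ∧
      (∀ z, u₁ z = z * v₁ z) ∧ ∀ z, u₂ z = z * v₂ z := by
  obtain ⟨v₁, hv₁, huv₁⟩ := (dbarFlat_of_system ha hb h₁ h₂ e₁ e₂ z₁ z₂).exists_eq_mul
  obtain ⟨v₂, hv₂, huv₂⟩ := (dbarFlat_of_system hb ha h₂ h₁ e₂ e₁ z₂ z₁).exists_eq_mul
  exact ⟨v₁, v₂, hv₁, hv₂, system_of_eq_mul ha.continuous hv₁ hv₂.continuous e₁ huv₁ huv₂,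
    system_of_eq_mul hb.continuous hv₂ hv₁.continuous e₂ huv₂ huv₁, huv₁, huv₂⟩

end System

theorem isPrimitiveRoot_ω : IsPrimitiveRoot ω 3 := by
  simpa [ω] using Complex.isPrimitiveRoot_exp 3 (by norm_num)

theorem ω_ne_zero : ω ≠ 0 := Complex.exp_ne_zero _

theorem ω_ne_one : ω ≠ 1 := isPrimitiveRoot_ω.ne_one (by norm_num)

theorem eq_zero_of_rotation {f : ℂ → ℂ} (h : ∀ z, f (ω * z) = ω⁻¹ * f z) : f 0 = 0 := by
  have h0 := h 0
  rw [mul_zero, eq_comm, ← sub_eq_zero, ← sub_one_mul] at h0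
  exact (mul_eq_zero.1 h0).resolve_left (sub_ne_zero.2 (inv_ne_one.2 ω_ne_one))

theorem eq_zero_of_rotation_of_eq_mul {f v : ℂ → ℂ} (h : ∀ z, f (ω * z) = ω⁻¹ * f z)
    (hv : Continuous v) (hfv : ∀ z, f z = z * v z) : v 0 = 0 := by
  have hrot : (fun z => v (ω * z)) = fun z => ω * v z := by
    refine eq_of_forall_ne_zero (by fun_prop) (by fun_prop) fun z hz => ?_
    have h' := h z
    have hω := ω_ne_zero
    have h3 : ω ^ 3 = 1 := isPrimitiveRoot_ω.pow_eq_one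
    rw [hfv, hfv] at h'
    field_simp at h'
    linear_combination ω * h' - v (ω * z) * h3
  have h0 := congrFun hrot 0
  simp only [mul_zero] at h0
  rw [eq_comm, ← sub_eq_zero, ← sub_one_mul] at h0
  exact (mul_eq_zero.1 h0).resolve_left (sub_ne_zero.2 ω_ne_one)

/-- **second-order vanishing in the first representation.**
Every `u ∈ Ker₁(α)` factors as `u(z) = z²·w(z)` with `w` smooth. -/
theorem second_order_vanishing (U : ℂ → ℂ) (hU : IsTunnelling U) (α : ℂ)
    (u : ℂ → ℂ × ℂ) (hu : u ∈ kerPSet U (fun z => U (-z)) α 1) :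
    ∃ w : ℂ → ℂ × ℂ, ContDiff ℝ (⊤ : ℕ∞) w ∧ ∀ z : ℂ, u z = (z ^ 2) • w z := by
  obtain ⟨⟨hu, e₁, e₂, -, -⟩, hrot⟩ := hu
  have ha : ContDiff ℝ (⊤ : ℕ∞) fun z => α * U z := contDiff_const.mul hU.1
  have hb : ContDiff ℝ (⊤ : ℕ∞) fun z => α * U (-z) :=
    contDiff_const.mul (hU.1.comp contDiff_neg)
  have r₁ : ∀ z, (u (ω * z)).1 = ω⁻¹ * (u z).1 := fun z => by simp [hrot z]
  have r₂ : ∀ z, (u (ω * z)).2 = ω⁻¹ * (u z).2 := fun z => by simp [hrot z]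
  simp only [zero_mul, add_zero] at e₁ e₂
  obtain ⟨v₁, v₂, hv₁, hv₂, f₁, f₂, huv₁, huv₂⟩ := exists_system_eq_mul ha hb hu.fst hu.snd
    e₁ e₂ (eq_zero_of_rotation (f := fun z => (u z).1) r₁)
    (eq_zero_of_rotation (f := fun z => (u z).2) r₂)
  obtain ⟨w₁, w₂, hw₁, hw₂, -, -, hvw₁, hvw₂⟩ := exists_system_eq_mul ha hb hv₁ hv₂ f₁ f₂
    (eq_zero_of_rotation_of_eq_mul (f := fun z => (u z).1) r₁ hv₁.continuous huv₁)
    (eq_zero_of_rotation_of_eq_mul (f := fun z => (u z).2) r₂ hv₂.continuous huv₂)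
  refine ⟨fun z => (w₁ z, w₂ z), hw₁.prodMk hw₂, fun z => Prod.ext ?_ ?_⟩
  · simp only [Prod.smul_fst, smul_eq_mul, huv₁, hvw₁]
    ring
  · simp only [Prod.smul_snd, smul_eq_mul, huv₂, hvw₂]
    ring

end TBG
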